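/- Let n be a positive integer. There exists a positive integer N = N(n) such that the following holds: if X is a linked set in a finite digraph D and A, B ⊆ X are disjoint with |A| = |B| = N, then there are subsets A′ ⊆ A and B′ ⊆ B with |A′| = |B′| = n, a linkage of n pairwise vertex-disjoint directed paths from A′ to B′, and a linkage of n pairwise vertex-disjoint directed paths from B′ to A′, such that these two linkages either agree or cross. -/

import Mathlib

/-- A directed path in the digraph with adjacency relation `A`: a nonempty list of
distinct vertices in which each consecutive pair is joined by an edge directed forwards. -/
def IsDipath {V : Type*} (A : V → V → Prop) (l : List V) : Prop :=
  l ≠ [] ∧ l.Nodup ∧ l.Chain' A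

/-- A directed path all of whose vertices lie in the set `S`. -/
def DipathIn {V : Type*} (A : V → V → Prop) (S : Set V) (l : List V) : Prop :=
  IsDipath A l ∧ ∀ v ∈ l, v ∈ S

/-- A directed path from `u` to `v`. -/
def DipathFromTo {V : Type*} (A : V → V → Prop) (l : List V) (u v : V) : Prop :=
  IsDipath A l ∧ l.head? = some u ∧ l.getLast? = some v

/-- The digraph with adjacency `A` is strongly connected on the vertex set `S`:
any vertex of `S` can reach any other by a directed path staying inside `S`. -/
def StrongOn {V : Type*} (A : V → V → Prop) (S : Set V) : Prop :=
  ∀ u ∈ S, ∀ v ∈ S, ∃ l : List V, DipathIn A S l ∧ l.head? = some u ∧ l.getLast? = some v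

/-- `C` is (the vertex set of) a strong component of the subdigraph induced on `W`:
a maximal nonempty strongly connected subset of `W`. -/
def IsStrongComponent {V : Type*} (A : V → V → Prop) (W C : Set V) : Prop :=
  C ⊆ W ∧ C.Nonempty ∧ StrongOn A C ∧
    ∀ C' : Set V, C ⊆ C' → C' ⊆ W → StrongOn A C' → C' = C

/-- `B` is a haven of order `w` in the digraph with adjacency `A` and vertex set `S`:
for every `Z ⊆ S` with `|Z| < w`, `B Z` is a strong component of the digraph minus `Z`,
and `B Z ⊆ B Z'` whenever `Z' ⊆ Z` (the haven axiom). -/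
def IsHavenOn {V : Type*} (A : V → V → Prop) (S : Set V) (w : ℕ) (B : Finset V → Set V) : Prop :=
  ∀ Z : Finset V, ↑Z ⊆ S → Z.card < w →
    IsStrongComponent A (S \ ↑Z) (B Z) ∧ ∀ Z' : Finset V, Z' ⊆ Z → B Z ⊆ B Z'

/-- The digraph with adjacency `A` and vertex set `S` has a haven of order `w`. -/
def HasHavenOn {V : Type*} (A : V → V → Prop) (S : Set V) (w : ℕ) : Prop :=
  ∃ B : Finset V → Set V, IsHavenOn A S w B

/-- The digraph with adjacency `A` (on its whole vertex type) has a haven of order `w`. -/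
def HasHaven {V : Type*} (A : V → V → Prop) (w : ℕ) : Prop :=
  HasHavenOn A Set.univ w

/-- A linkage from the finite set `S` to the finite set `T`: for each `a ∈ S`,
`P a` is a directed path from `a` to `τ a ∈ T`, and the paths are pairwise vertex-disjoint
(so the ends `τ a` are distinct vertices of `T`). -/
def IsLinkage {V : Type*} (A : V → V → Prop) (S T : Finset V)
    (P : V → List V) (τ : V → V) : Prop :=
  (∀ a ∈ S, τ a ∈ T ∧ DipathFromTo A (P a) a (τ a)) ∧
  ∀ a₁ ∈ S, ∀ a₂ ∈ S, a₁ ≠ a₂ → ∀ v ∈ P a₁, v ∉ P a₂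

/-- `X` is linked: for every `S, T ⊆ X` with `|S| = |T|` there is a linkage of `|S|`
pairwise vertex-disjoint directed paths from `S` to `T`. -/
def Linked {V : Type*} (A : V → V → Prop) (X : Finset V) : Prop :=
  ∀ S T : Finset V, S ⊆ X → T ⊆ X → S.card = T.card →
    ∃ (P : V → List V) (τ : V → V), IsLinkage A S T P τ

/-- `(S, A')` is a subdigraph of the digraph with adjacency `A`: every edge of `A'`
is an edge of `A` with both ends in `S`. -/
def IsSubdigraph {V : Type*} (A : V → V → Prop) (S : Set V) (A' : V → V → Prop) : Prop :=
  ∀ u v, A' u v → A u v ∧ u ∈ S ∧ v ∈ S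

/-- The digraph with adjacency `A` and vertex set `S` is `k`-eulerianizable: it is strongly
connected and one can assign a positive multiplicity to each edge so that at every vertex the
total multiplicity of in-edges equals that of the out-edges and both are at most `k`. -/
def Eulerianizable {V : Type*} [Fintype V] (A : V → V → Prop) (S : Set V) (k : ℕ) : Prop :=
  StrongOn A S ∧ ∃ m : V → V → ℕ,
    (∀ u v, A u v → 1 ≤ m u v) ∧ (∀ u v, ¬ A u v → m u v = 0) ∧
    ∀ v ∈ S, (∑ u, m u v) = (∑ u, m v u) ∧ (∑ u, m v u) ≤ k

/-- With respect to the orders given by `f` on `S` and `g` on the target set, the end map `τ`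
of a linkage starting in `S` is monotone increasing. -/
def MonoIncrOn {V : Type*} (S : Finset V) (τ : V → V) (f g : V → ℕ) : Prop :=
  ∀ a₁ ∈ S, ∀ a₂ ∈ S, f a₁ < f a₂ → g (τ a₁) < g (τ a₂)

/-- With respect to the orders given by `f` on `S` and `g` on the target set, the end map `τ`
of a linkage starting in `S` is monotone decreasing. -/
def MonoDecrOn {V : Type*} (S : Finset V) (τ : V → V) (f g : V → ℕ) : Prop :=
  ∀ a₁ ∈ S, ∀ a₂ ∈ S, f a₁ < f a₂ → g (τ a₂) < g (τ a₁)

/-- A linkage from `S` to `T` (with end map `τ`) and one from `T` to `S` (with end map `σ`)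
agree: there are linear orders on `S` and on `T` making both monotone increasing. -/
def LinkagesAgree {V : Type*} (S T : Finset V) (τ σ : V → V) : Prop :=
  ∃ f g : V → ℕ, Set.InjOn f ↑S ∧ Set.InjOn g ↑T ∧
    MonoIncrOn S τ f g ∧ MonoIncrOn T σ g f

/-- The two linkages cross: there are linear orders on `S` and on `T` making one of them
monotone increasing and the other monotone decreasing. -/
def LinkagesCross {V : Type*} (S T : Finset V) (τ σ : V → V) : Prop :=
  ∃ f g : V → ℕ, Set.InjOn f ↑S ∧ Set.InjOn g ↑T ∧
    ((MonoIncrOn S τ f g ∧ MonoDecrOn T σ g f) ∨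
     (MonoDecrOn S τ f g ∧ MonoIncrOn T σ g f))

/-- Ramsey's theorem for colourings of the `k`-element sets, with a prescribed size for a
homogeneous set of each colour. -/
theorem exists_homogeneous_card_ge (κ : Type) [Fintype κ] (k : ℕ) (M : κ → ℕ) :
    ∃ N : ℕ, ∀ (α : Type) (X : Finset α) (c : Finset α → κ), N ≤ X.card →
      ∃ (d : κ) (H : Finset α), H ⊆ X ∧ M d ≤ H.card ∧ ∀ S ⊆ H, S.card = k → c S = d := by
  classical
  induction k generalizing M with
  | zero =>
    refine ⟨∑ d, M d, fun α X c hX => ⟨c ∅, X, subset_rfl, ?_, fun S _ hS => ?_⟩⟩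
    · exact (Finset.single_le_sum (f := M) (fun _ _ => Nat.zero_le _)
        (Finset.mem_univ (c ∅))).trans hX
    · rw [Finset.card_eq_zero.1 hS]
  | succ k ihk =>
    induction hs : ∑ d, M d using Nat.strong_induction_on generalizing M with
    | _ s ih =>
      by_cases h0 : ∃ d, M d = 0
      · obtain ⟨d, hd⟩ := h0
        refine ⟨0, fun α X c _ => ⟨d, ∅, Finset.empty_subset X, by simp [hd], fun S hS hc => ?_⟩⟩
        simp [Finset.subset_empty.1 hS] at hc
      push Not at h0
      have hred : ∀ d : κ, ∃ N : ℕ, ∀ (α : Type) (X : Finset α) (c : Finset α → κ), N ≤ X.card →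
          ∃ (e : κ) (H : Finset α), H ⊆ X ∧ Function.update M d (M d - 1) e ≤ H.card ∧
            ∀ S ⊆ H, S.card = k + 1 → c S = e := by
        intro d
        refine ih _ ?_ _ rfl
        rw [← hs]
        refine Finset.sum_lt_sum (fun e _ => ?_) ⟨d, Finset.mem_univ d, ?_⟩
        · by_cases h : e = d
          · subst h; simp
          · simp [h]
        · have := h0 d
          simp only [Function.update_self]
          omega
      choose R hR using hred
      obtain ⟨N, hN⟩ := ihk R
      refine ⟨N + 1, fun α X c hX => ?_⟩
      obtain ⟨x, hx⟩ := Finset.card_pos.1 (by omega : 0 < X.card)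
      obtain ⟨d, H, hHX, hH, hHc⟩ := hN α (X.erase x) (fun S => c (insert x S))
        (by rw [Finset.card_erase_of_mem hx]; omega)
      obtain ⟨e, H', hH'H, hH', hH'c⟩ := hR d α H c hH
      have hxH' : x ∉ H' := fun h => by simpa using hHX (hH'H h)
      by_cases hed : e = d
      · subst hed
        refine ⟨e, insert x H', ?_, ?_, fun S hS hSc => ?_⟩
        · exact Finset.insert_subset hx ((hH'H.trans hHX).trans (Finset.erase_subset _ _))
        · rw [Finset.card_insert_of_notMem hxH']
          simp only [Function.update_self] at hH'
          omega
        · by_cases hxS : x ∈ S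
          · have := hHc (S.erase x) ((Finset.subset_insert_iff.1 hS).trans hH'H)
              (by rw [Finset.card_erase_of_mem hxS]; omega)
            rwa [Finset.insert_erase hxS] at this
          · exact hH'c S ((Finset.subset_insert_iff_of_notMem hxS).1 hS) hSc
      · refine ⟨e, H', (hH'H.trans hHX).trans (Finset.erase_subset _ _), ?_, hH'c⟩
        simpa [hed] using hH'

/-- The product Ramsey theorem for colourings of pairs of `k`-element sets. -/
theorem exists_homogeneous_prod (κ : Type) [Fintype κ] (k M : ℕ) :
    ∃ N : ℕ, ∀ (α : Type) (X Y : Finset α) (c : Finset α → Finset α → κ),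
      N ≤ X.card → N ≤ Y.card →
      ∃ (d : κ) (H K : Finset α), H ⊆ X ∧ K ⊆ Y ∧ H.card = M ∧ K.card = M ∧
        ∀ S ⊆ H, ∀ T ⊆ K, S.card = k → T.card = k → c S T = d := by
  classical
  obtain ⟨N₂, hN₂⟩ := exists_homogeneous_card_ge κ k (fun _ => M)
  obtain ⟨N₁, hN₁⟩ := exists_homogeneous_card_ge (Finset (Fin N₂) → κ) k (fun _ => M)
  refine ⟨max N₁ N₂, fun α X Y c hX hY => ?_⟩
  obtain ⟨Y', hY'Y, hY'⟩ := Finset.exists_subset_card_eq ((le_max_right _ _).trans hY)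
  let b : Fin N₂ ↪ α := (Y'.equivFinOfCardEq hY').symm.toEmbedding.trans (.subtype _)
  have hb : ∀ i, b i ∈ Y' := fun i => ((Y'.equivFinOfCardEq hY').symm i).2
  obtain ⟨φ, H₀, hH₀X, hH₀, hφ⟩ := hN₁ α X (fun S U => c S (U.map b))
    ((le_max_left _ _).trans hX)
  obtain ⟨H, hHH₀, hH⟩ := Finset.exists_subset_card_eq hH₀
  obtain ⟨d, K₀, -, hK₀, hd⟩ := hN₂ (Fin N₂) Finset.univ φ (by simp)
  obtain ⟨K, hKK₀, hK⟩ := Finset.exists_subset_card_eq hK₀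
  refine ⟨d, H, K.map b, hHH₀.trans hH₀X, fun y hy => ?_, hH, by simpa using hK,
    fun S hS T hT hSc hTc => ?_⟩
  · obtain ⟨i, -, rfl⟩ := Finset.mem_map.1 hy
    exact hY'Y (hb i)
  · obtain ⟨U, hU, rfl⟩ := Finset.subset_map_iff.1 hT
    rw [Finset.card_map] at hTc
    rw [← hd U (hU.trans hKK₀) hTc, ← hφ S (hS.trans hHH₀) hSc]

section Linkage

variable {V : Type} {A : V → V → Prop} {S T : Finset V} {P : V → List V} {τ : V → V}

theorem IsLinkage.injOn (h : IsLinkage A S T P τ) : Set.InjOn τ S := by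
  intro a ha b hb hab
  by_contra hne
  have hlast : ∀ x ∈ S, τ x ∈ P x := fun x hx => List.mem_of_getLast? (h.1 x hx).2.2.2
  exact h.2 a ha b hb hne _ (hlast a ha) (hab ▸ hlast b hb)

theorem IsLinkage.restrict [DecidableEq V] (h : IsLinkage A S T P τ) {S' : Finset V}
    (hS : S' ⊆ S) : IsLinkage A S' (S'.image τ) P τ :=
  ⟨fun a ha => ⟨Finset.mem_image_of_mem τ ha, (h.1 a (hS ha)).2⟩,
    fun a ha b hb => h.2 a (hS ha) b (hS hb)⟩

variable (A) in
/-- There is a linkage from `S` to `T` that is monotone increasing for the orders `f`, `g`. -/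
def HasIncrLinkage (f g : V → ℕ) (S T : Finset V) : Prop :=
  ∃ P τ, IsLinkage A S T P τ ∧ MonoIncrOn S τ f g

variable (A) in
/-- There is a linkage from `S` to `T` that is monotone decreasing for the orders `f`, `g`. -/
def HasDecrLinkage (f g : V → ℕ) (S T : Finset V) : Prop :=
  ∃ P τ, IsLinkage A S T P τ ∧ MonoDecrOn S τ f g

end Linkage

/-- A sufficiently large linkage contains a monotone linkage of size `n`. -/
theorem exists_monotone_sublinkage (n : ℕ) :
    ∃ m : ℕ, n ≤ m ∧ ∀ (V : Type) (A : V → V → Prop) (S T : Finset V) (P : V → List V)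
      (τ : V → V) (f g : V → ℕ), g.Injective → IsLinkage A S T P τ → m ≤ S.card →
      ∃ S' ⊆ S, ∃ T' ⊆ T, S'.card = n ∧ T'.card = n ∧
        (HasIncrLinkage A f g S' T' ∨ HasDecrLinkage A f g S' T') := by
  classical
  obtain ⟨m, hm⟩ := exists_homogeneous_card_ge Prop 2 (fun _ => n)
  refine ⟨max n m, le_max_left _ _, fun V A S T P τ f g hg hP hS => ?_⟩
  obtain ⟨d, H₀, hH₀S, hH₀, hd⟩ := hm V S (fun U => MonoIncrOn U τ f g)
    ((le_max_right _ _).trans hS)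
  obtain ⟨H, hHH₀, hH⟩ := Finset.exists_subset_card_eq hH₀
  have hHS := hHH₀.trans hH₀S
  refine ⟨H, hHS, H.image τ, ?_, hH, ?_, ?_⟩
  · exact Finset.image_subset_iff.2 fun a ha => (hP.1 a (hHS ha)).1
  · rw [Finset.card_image_of_injOn (hP.injOn.mono (by exact_mod_cast hHS)), hH]
  have hpair : ∀ x ∈ H, ∀ y ∈ H, f x < f y → (MonoIncrOn {x, y} τ f g ↔ d) := by
    intro x hx y hy hxy
    refine iff_of_eq (hd {x, y} ?_ (Finset.card_pair ?_))
    · exact (Finset.insert_subset hx (Finset.singleton_subset_iff.2 hy)).trans hHH₀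
    · rintro rfl; exact lt_irrefl _ hxy
  by_cases hd' : d
  · refine .inl ⟨P, τ, hP.restrict hHS, fun x hx y hy hxy => ?_⟩
    exact (hpair x hx y hy hxy).2 hd' x (by simp) y (by simp) hxy
  · refine .inr ⟨P, τ, hP.restrict hHS, fun x hx y hy hxy => ?_⟩
    by_contra hlt
    refine hd' ((hpair x hx y hy hxy).1 ?_)
    have hne : g (τ x) ≠ g (τ y) := fun h =>
      hxy.ne (congrArg f (hP.injOn (hHS hx) (hHS hy) (hg h)))
    intro u hu v hv huv
    simp only [Finset.mem_insert, Finset.mem_singleton] at hu hv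
    rcases hu with rfl | rfl <;> rcases hv with rfl | rfl <;> omega

/-- For every `n ≥ 1` there is `N` such that for any linked set `X` in a
finite digraph and disjoint `A, B ⊆ X` of size `N`, there are `A' ⊆ A`, `B' ⊆ B` of size `n`,
a linkage from `A'` to `B'` and a linkage from `B'` to `A'` that agree or cross. -/
theorem linkages_agree_or_cross (n : ℕ) (hn : 0 < n) :
    ∃ N : ℕ, 0 < N ∧
      ∀ (V : Type) [Fintype V] [DecidableEq V] (A : V → V → Prop)
        (X Aset Bset : Finset V),
        Linked A X → Aset ⊆ X → Bset ⊆ X → Disjoint Aset Bset →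
        Aset.card = N → Bset.card = N →
        ∃ (A' B' : Finset V) (P : V → List V) (τ : V → V) (Q : V → List V) (σ : V → V),
          A' ⊆ Aset ∧ B' ⊆ Bset ∧ A'.card = n ∧ B'.card = n ∧
          IsLinkage A A' B' P τ ∧ IsLinkage A B' A' Q σ ∧
          (LinkagesAgree A' B' τ σ ∨ LinkagesCross A' B' τ σ) := by
  classical
  obtain ⟨m, hnm, hm⟩ := exists_monotone_sublinkage n
  obtain ⟨N, hN⟩ := exists_homogeneous_prod (Prop × Prop × Prop × Prop) n m
  refine ⟨N + 1, N.succ_pos, fun V _ _ A X Aset Bset hX hA hB _ hAc hBc => ?_⟩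
  let f : V → ℕ := fun v => Fintype.equivFin V v
  have hf : f.Injective := Fin.val_injective.comp (Fintype.equivFin V).injective
  have hlt : ∀ v, f v < Fintype.card V := fun v => (Fintype.equivFin V v).2
  obtain ⟨d, H, K, hHA, hKB, hH, hK, hd⟩ := hN V Aset Bset
    (fun S T => (HasIncrLinkage A f f S T, HasDecrLinkage A f f S T,
      HasIncrLinkage A f f T S, HasDecrLinkage A f f T S)) (by omega) (by omega)
  obtain ⟨S, hSH, hS⟩ := Finset.exists_subset_card_eq (hnm.trans hH.ge)
  obtain ⟨T, hTK, hT⟩ := Finset.exists_subset_card_eq (hnm.trans hK.ge)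
  have htransfer : ∀ S' ⊆ H, ∀ T' ⊆ K, S'.card = n → T'.card = n →
      HasIncrLinkage A f f S' T' = HasIncrLinkage A f f S T ∧
      HasDecrLinkage A f f S' T' = HasDecrLinkage A f f S T ∧
      HasIncrLinkage A f f T' S' = HasIncrLinkage A f f T S ∧
      HasDecrLinkage A f f T' S' = HasDecrLinkage A f f T S := by
    intro S' hS' T' hT' hSc hTc
    simpa only [Prod.mk.injEq] using
      (hd S' hS' T' hT' hSc hTc).trans (hd S hSH T hTK hS hT).symm
  have hforth : HasIncrLinkage A f f S T ∨ HasDecrLinkage A f f S T := by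
    obtain ⟨P, τ, hP⟩ := hX H K (hHA.trans hA) (hKB.trans hB) (hH.trans hK.symm)
    obtain ⟨S', hS', T', hT', hSc, hTc, h⟩ := hm V A H K P τ f f hf hP hH.ge
    obtain ⟨h₁, h₂, -, -⟩ := htransfer S' hS' T' hT' hSc hTc
    rwa [h₁, h₂] at h
  have hback : HasIncrLinkage A f f T S ∨ HasDecrLinkage A f f T S := by
    obtain ⟨P, τ, hP⟩ := hX K H (hKB.trans hB) (hHA.trans hA) (hK.trans hH.symm)
    obtain ⟨T', hT', S', hS', hTc, hSc, h⟩ := hm V A K H P τ f f hf hP hK.ge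
    obtain ⟨-, -, h₁, h₂⟩ := htransfer S' hS' T' hT' hSc hTc
    rwa [h₁, h₂] at h
  have hSA := hSH.trans hHA
  have hTB := hTK.trans hKB
  obtain ⟨P, τ, hP, hτ⟩ | ⟨P, τ, hP, hτ⟩ := hforth <;>
    obtain ⟨Q, σ, hQ, hσ⟩ | ⟨Q, σ, hQ, hσ⟩ := hback <;>
    refine ⟨S, T, P, τ, Q, σ, hSA, hTB, hS, hT, hP, hQ, ?_⟩
  · exact .inl ⟨f, f, hf.injOn, hf.injOn, hτ, hσ⟩
  · exact .inr ⟨f, f, hf.injOn, hf.injOn, .inl ⟨hτ, hσ⟩⟩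
  · exact .inr ⟨f, f, hf.injOn, hf.injOn, .inr ⟨hτ, hσ⟩⟩
  · refine .inl ⟨f, fun v => Fintype.card V - f v, hf.injOn, ?_, ?_, ?_⟩
    · intro u _ v _ huv
      have hu := hlt u
      have hv := hlt v
      exact hf (by simp only at huv; omega)
    · intro a ha b hb hab
      have := hτ a ha b hb hab
      have := hlt (τ a)
      simp only
      omega
    · intro a ha b hb hab
      exact hσ b hb a ha (by simp only at hab; omega)
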